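/- Let P1 and P2 be arbitrary logic programs. If there is a 3-valued interpretation that models P1 and does not model P2, then there exists a program P such that either (i) P1 ∪ P is intuitionistically consistent and complete while P2 ∪ P is intuitionistically inconsistent, or (ii) P1 ∪ P is incomplete and for every set Δ of negated atoms the theory P1 ∪ P ∪ Δ fails to be both consistent and complete, while P2 ∪ P is intuitionistically consistent and complete. -/

import Mathlib

namespace ASP

/-- Propositional formulas over atoms `α`, built with ∧, ∨, ← and ⊥.
`impl A B` denotes the formula `B ← A` (i.e. `A → B`). -/
inductive PropForm (α : Type) : Type
  | var : α → PropForm α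
  | fals : PropForm α
  | conj : PropForm α → PropForm α → PropForm α
  | disj : PropForm α → PropForm α → PropForm α
  | impl : PropForm α → PropForm α → PropForm α
  deriving DecidableEq

namespace PropForm

variable {α : Type}

/-- `¬F` abbreviates `⊥ ← F`. -/
def neg (A : PropForm α) : PropForm α := impl A fals

/-- `⊤` abbreviates `⊥ ← ⊥`. -/
def top : PropForm α := impl fals fals

/-- The set of atoms occurring in a formula. -/
def atoms : PropForm α → Set α
  | var a => {a}
  | fals => ∅
  | conj A B => atoms A ∪ atoms B
  | disj A B => atoms A ∪ atoms B
  | impl A B => atoms A ∪ atoms B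

end PropForm

open PropForm

/-- Hilbert-style derivability for intuitionistic propositional logic,
with an extra set `Ax` of additional axioms. -/
inductive Deriv {α : Type} (Ax : Set (PropForm α)) : PropForm α → Prop
  | ax {A} : A ∈ Ax → Deriv Ax A
  | k (A B) : Deriv Ax (impl A (impl B A))
  | s (A B C) : Deriv Ax (impl (impl A (impl B C)) (impl (impl A B) (impl A C)))
  | conjIntro (A B) : Deriv Ax (impl A (impl B (conj A B)))
  | conjElimL (A B) : Deriv Ax (impl (conj A B) A)
  | conjElimR (A B) : Deriv Ax (impl (conj A B) B)
  | disjIntroL (A B) : Deriv Ax (impl A (disj A B))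
  | disjIntroR (A B) : Deriv Ax (impl B (disj A B))
  | disjElim (A B C) : Deriv Ax (impl (impl A C) (impl (impl B C) (impl (disj A B) C)))
  | falsElim (A) : Deriv Ax (impl fals A)
  | mp {A B} : Deriv Ax (impl A B) → Deriv Ax A → Deriv Ax B

/-- `F` is a theorem of intuitionistic propositional logic. -/
def IThm {α : Type} (F : PropForm α) : Prop := Deriv ∅ F

/-- `F` is a theorem of classical propositional logic
(intuitionistic logic plus double-negation elimination). -/
def CThm {α : Type} (F : PropForm α) : Prop :=
  Deriv {F | ∃ A, F = impl (neg (neg A)) A} F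

/-- Conjunction of a finite list of formulas (empty conjunction is ⊤). -/
def bigConj {α : Type} : List (PropForm α) → PropForm α
  | [] => top
  | [A] => A
  | A :: L => conj A (bigConj L)

/-- Disjunction of a finite list of formulas (empty disjunction is ⊥). -/
def bigDisj {α : Type} : List (PropForm α) → PropForm α
  | [] => fals
  | [A] => A
  | A :: L => disj A (bigDisj L)

/-- `T ⊢_X F`: the formula `F ← (F₁ ∧ ... ∧ Fₙ)` is a theorem of the logic
whose theorems are `Thm`, for some `F₁, ..., Fₙ ∈ T`. -/
def ProvesFrom {α : Type} (Thm : PropForm α → Prop) (T : Set (PropForm α))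
    (F : PropForm α) : Prop :=
  ∃ L : List (PropForm α), (∀ G ∈ L, G ∈ T) ∧ Thm (impl (bigConj L) F)

/-- `T ⊢_I F`. -/
def IProves {α : Type} (T : Set (PropForm α)) (F : PropForm α) : Prop :=
  ProvesFrom IThm T F

/-- `T ⊢_C F`. -/
def CProves {α : Type} (T : Set (PropForm α)) (F : PropForm α) : Prop :=
  ProvesFrom CThm T F

/-- `T` is consistent in intuitionistic logic. -/
def IConsistent {α : Type} (T : Set (PropForm α)) : Prop := ¬ IProves T fals

/-- `T ⊩_I M`: `T` is consistent and proves (intuitionistically) every atom of `M`. -/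
def IProvesAll {α : Type} (T : Set (PropForm α)) (M : Set α) : Prop :=
  IConsistent T ∧ ∀ a ∈ M, IProves T (var a)

/-- `T ≡_I U`: the two theories prove each other's formulas intuitionistically. -/
def IEquivTh {α : Type} (T U : Set (PropForm α)) : Prop :=
  (∀ F ∈ U, IProves T F) ∧ (∀ F ∈ T, IProves U F)

/-- The signature (set of occurring atoms) of a theory. -/
def sigTh {α : Type} (T : Set (PropForm α)) : Set α := ⋃ F ∈ T, F.atoms

/-- `T` is (literal) complete: for every atom `a` of its signature,
`T ⊢_I a` or `T ⊢_I ¬a`. -/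
def IComplete {α : Type} (T : Set (PropForm α)) : Prop :=
  ∀ a ∈ sigTh T, IProves T (var a) ∨ IProves T (neg (var a))

/-- `{¬a : a ∈ S}`. -/
def negSet {α : Type} (S : Set α) : Set (PropForm α) := (fun a => neg (var a)) '' S

/-- `{¬¬a : a ∈ S}`. -/
def negnegSet {α : Type} (S : Set α) : Set (PropForm α) :=
  (fun a => neg (neg (var a))) '' S

/-- Classical two-valued satisfaction, identifying an interpretation with the
set of atoms it makes true. -/
def sat2 {α : Type} (X : Set α) : PropForm α → Prop
  | .var a => a ∈ X
  | .fals => False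
  | .conj A B => sat2 X A ∧ sat2 X B
  | .disj A B => sat2 X A ∨ sat2 X B
  | .impl A B => sat2 X A → sat2 X B

/-- `X` is a classical model of the theory `T`. -/
def isModel2 {α : Type} (X : Set α) (T : Set (PropForm α)) : Prop := ∀ F ∈ T, sat2 X F

/-- `M` is a minimal (under ⊆) classical model of `T`. -/
def isMinModel {α : Type} (T : Set (PropForm α)) (M : Set α) : Prop :=
  isModel2 M T ∧ ∀ N ⊆ M, isModel2 N T → N = M

/-- Evaluation in the 3-valued Gödel logic G3. -/
def g3 {α : Type} (I : α → Fin 3) : PropForm α → Fin 3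
  | .var a => I a
  | .fals => 0
  | .conj A B => min (g3 I A) (g3 I B)
  | .disj A B => max (g3 I A) (g3 I B)
  | .impl A B => if g3 I A ≤ g3 I B then 2 else g3 I B

/-- Nested formulas: built from atoms, ⊤ and ⊥ using ∧, ∨ and ¬. -/
inductive NF (α : Type) : Type
  | var : α → NF α
  | top : NF α
  | bot : NF α
  | conj : NF α → NF α → NF α
  | disj : NF α → NF α → NF α
  | neg : NF α → NF α
  deriving DecidableEq

namespace NF

variable {α : Type}

/-- Reading a nested formula as a propositional formula
(`⊤ = ⊥ ← ⊥` and `¬F = ⊥ ← F`). -/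
def toProp : NF α → PropForm α
  | var a => .var a
  | top => PropForm.top
  | bot => .fals
  | conj A B => .conj (toProp A) (toProp B)
  | disj A B => .disj (toProp A) (toProp B)
  | neg A => PropForm.neg (toProp A)

/-- Atoms occurring in a nested formula. -/
def atoms : NF α → Set α
  | var a => {a}
  | top => ∅
  | bot => ∅
  | conj A B => atoms A ∪ atoms B
  | disj A B => atoms A ∪ atoms B
  | neg A => atoms A

/-- Satisfaction of a (basic, negation-free) nested formula by a set of atoms. -/
def satB (X : Set α) : NF α → Prop
  | var a => a ∈ X
  | top => True
  | bot => False
  | conj A B => satB X A ∧ satB X B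
  | disj A B => satB X A ∨ satB X B
  | neg A => ¬ satB X A

open scoped Classical in
/-- The reduct `F^X`: each maximal subformula `¬G` is replaced by ⊥ if
`X ⊨ G^X` and by ⊤ otherwise. -/
noncomputable def reduct (X : Set α) : NF α → NF α
  | var a => var a
  | top => top
  | bot => bot
  | conj A B => conj (reduct X A) (reduct X B)
  | disj A B => disj (reduct X A) (reduct X B)
  | neg A => if satB X (reduct X A) then bot else top

end NF

/-- An augmented clause `H ← B` is a pair `(H, B)` of nested formulas. -/
abbrev AugClause (α : Type) := NF α × NF α

/-- The propositional formula `H ← B` of an augmented clause. -/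
def clauseToProp {α : Type} (c : AugClause α) : PropForm α :=
  .impl c.2.toProp c.1.toProp

/-- The theory of an augmented program. -/
def progTh {α : Type} (P : List (AugClause α)) : Set (PropForm α) :=
  {F | ∃ c ∈ P, clauseToProp c = F}

/-- The signature of an augmented program. -/
def progSig {α : Type} (P : List (AugClause α)) : Set α :=
  {a | ∃ c ∈ P, a ∈ c.1.atoms ∪ c.2.atoms}

/-- `X` is closed under the (basic) program `P`: for each clause `H ← B`,
`X ⊨ H` whenever `X ⊨ B`. -/
def closedUnder {α : Type} (X : Set α) (P : List (AugClause α)) : Prop :=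
  ∀ c ∈ P, NF.satB X c.2 → NF.satB X c.1

/-- The reduct `P^X` of an augmented program. -/
noncomputable def progReduct {α : Type} (X : Set α) (P : List (AugClause α)) :
    List (AugClause α) :=
  P.map fun c => (c.1.reduct X, c.2.reduct X)

/-- `M` is an answer set of `P`: `M` is minimal (under ⊆) among the sets of
atoms closed under the reduct `P^M`. -/
def isAnswerSet {α : Type} (P : List (AugClause α)) (M : Set α) : Prop :=
  closedUnder M (progReduct M P) ∧ ∀ N ⊆ M, closedUnder N (progReduct M P) → N = M

/-- `M` is a min-answer set of `P`: both an answer set and a minimal model. -/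
def isMinAnswerSet {α : Type} (P : List (AugClause α)) (M : Set α) : Prop :=
  isAnswerSet P M ∧ isMinModel (progTh P) M

/-- A G3 interpretation models an augmented program. -/
def g3ModelsProg {α : Type} (I : α → Fin 3) (P : List (AugClause α)) : Prop :=
  ∀ c ∈ P, g3 I (clauseToProp c) = 2

/-- A free clause: a list of head literals and a list of body literals,
a literal being an atom `(a, true)` or a negated atom `(a, false)`.
It denotes `h₁ ∨ ... ∨ hₙ ← b₁ ∧ ... ∧ bₘ` (empty head = ⊥, empty body = ⊤). -/
structure FClause (α : Type) where
  head : List (α × Bool)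
  body : List (α × Bool)
  deriving DecidableEq

/-- The propositional formula of a literal. -/
def litToProp {α : Type} : α × Bool → PropForm α
  | (a, true) => .var a
  | (a, false) => PropForm.neg (.var a)

/-- The nested formula of a literal. -/
def litToNF {α : Type} : α × Bool → NF α
  | (a, true) => .var a
  | (a, false) => .neg (.var a)

/-- Disjunction of a list of nested formulas (empty = ⊥). -/
def bigDisjNF {α : Type} : List (NF α) → NF α
  | [] => .bot
  | [A] => A
  | A :: L => .disj A (bigDisjNF L)

/-- Conjunction of a list of nested formulas (empty = ⊤). -/
def bigConjNF {α : Type} : List (NF α) → NF α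
  | [] => .top
  | [A] => A
  | A :: L => .conj A (bigConjNF L)

namespace FClause

variable {α : Type}

/-- The propositional formula of a free clause. -/
def toProp (c : FClause α) : PropForm α :=
  .impl (bigConj (c.body.map litToProp)) (bigDisj (c.head.map litToProp))

/-- A free clause as an augmented clause. -/
def toAug (c : FClause α) : AugClause α :=
  (bigDisjNF (c.head.map litToNF), bigConjNF (c.body.map litToNF))

/-- The atoms of a free clause. -/
def atomsF (c : FClause α) : Set α :=
  {a | (∃ b, (a, b) ∈ c.head) ∨ (∃ b, (a, b) ∈ c.body)}

/-- A general clause: all head literals are positive atoms. -/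
def isGeneral (c : FClause α) : Prop := ∀ l ∈ c.head, l.2 = true

/-- A disjunctive clause: a general clause with nonempty head. -/
def isDisjunctive (c : FClause α) : Prop := c.isGeneral ∧ c.head ≠ []

/-- A constraint: a clause with empty head (head ⊥). -/
def isConstraint (c : FClause α) : Prop := c.head = []

end FClause

/-- The theory of a free program. -/
def fTh {α : Type} (P : List (FClause α)) : Set (PropForm α) :=
  {F | ∃ c ∈ P, c.toProp = F}

/-- The signature of a free program. -/
def fSig {α : Type} (P : List (FClause α)) : Set α :=
  {a | ∃ c ∈ P, a ∈ c.atomsF}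

/-- `GenDisj(P)`: each constraint `⊥ ← B` is replaced by `p ← B ∧ ¬p`,
where `p` is a new reserved atom. -/
def genDisj {α : Type} [DecidableEq α] (P : List (FClause α)) (p : α) :
    List (FClause α) :=
  P.map fun c =>
    if c.head = [] then ⟨[(p, true)], c.body ++ [(p, false)]⟩ else c

/-- The atoms `a` such that `¬a` occurs in the head of some clause of `P`
(the set `S` of the FreeGen transformation), as a list. -/
def headNegs {α : Type} (P : List (FClause α)) : List α :=
  P.flatMap fun c => c.head.filterMap fun l => if l.2 = false then some l.1 else none

open scoped Classical in
/-- Replace the occurrence of `¬a` (for `a ∈ S`) by the positive atom `φ a`. -/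
noncomputable def substLit {α : Type} (S : Set α) (φ : α → α) (l : α × Bool) :
    α × Bool :=
  if l.2 = false ∧ l.1 ∈ S then (φ l.1, true) else l

/-- Replace every occurrence of `¬a` (for `a ∈ S`) by `φ a` in a clause. -/
noncomputable def FClause.subst {α : Type} (S : Set α) (φ : α → α) (c : FClause α) :
    FClause α :=
  ⟨c.head.map (substLit S φ), c.body.map (substLit S φ)⟩

/-- `Δ_S = ⋃_{a ∈ S} {φ(a) ← ¬a, ⊥ ← a ∧ φ(a)}`. -/
def deltaClauses {α : Type} (L : List α) (φ : α → α) : List (FClause α) :=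
  L.flatMap fun a => [⟨[(φ a, true)], [(a, false)]⟩, ⟨[], [(a, true), (φ a, true)]⟩]

/-- `FreeGen(P) = P' ∪ Δ_S`. -/
noncomputable def freeGen {α : Type} (P : List (FClause α)) (φ : α → α) :
    List (FClause α) :=
  P.map (FClause.subst {a | a ∈ headNegs P} φ) ++ deltaClauses (headNegs P) φ

open scoped Classical in
/-- The second reduction `redu2(P; ¬¬M)`: clauses whose body contains a literal
`¬a` with `a ∈ M` are deleted; in constraints, positive body literals `a ∈ M`
are deleted. -/
noncomputable def redu2 {α : Type} [DecidableEq α] (P : List (FClause α))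
    (M : Set α) : List (FClause α) :=
  (P.filter fun c => decide (¬ ∃ l ∈ c.body, l.2 = false ∧ l.1 ∈ M)).map
    fun c =>
      if c.head = [] then
        ⟨[], c.body.filter fun l => decide (¬ (l.2 = true ∧ l.1 ∈ M))⟩
      else c

/-- `P₂` is a conservative extension of `P₁`: `M₁` is an answer set of `P₁`
iff `M₂` is an answer set of `P₂`, where `M₁ = M₂ ∩ σ_{P₁}`. -/
def consExt {α : Type} (P1 P2 : List (AugClause α)) : Prop :=
  (∀ M2 : Set α, isAnswerSet P2 M2 → isAnswerSet P1 (M2 ∩ progSig P1)) ∧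
  (∀ M1 : Set α, isAnswerSet P1 M1 →
    ∃ M2 : Set α, isAnswerSet P2 M2 ∧ M1 = M2 ∩ progSig P1)

/-- `P₂` is a strong conservative extension of the user program `P₁` (relative
to the user signature `U`): for every user program `P`, `P₂ ∪ P` is a
conservative extension of `P₁ ∪ P`. -/
def strongConsExt {α : Type} (P1 P2 : List (AugClause α)) (U : Set α) : Prop :=
  ∀ P : List (AugClause α), progSig P ⊆ U → consExt (P1 ++ P) (P2 ++ P)

mutual
  /-- Negation normal form: push negations inward (no pending negation). -/
  def nnf0 {α : Type} : NF α → NF α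
    | .var a => .var a
    | .top => .top
    | .bot => .bot
    | .conj A B => .conj (nnf0 A) (nnf0 B)
    | .disj A B => .disj (nnf0 A) (nnf0 B)
    | .neg A => nnf1 A
  /-- Negation normal form under one pending negation. -/
  def nnf1 {α : Type} : NF α → NF α
    | .var a => .neg (.var a)
    | .top => .bot
    | .bot => .top
    | .conj A B => .disj (nnf1 A) (nnf1 B)
    | .disj A B => .conj (nnf1 A) (nnf1 B)
    | .neg A => nnf2 A
  /-- Negation normal form under two pending negations. -/
  def nnf2 {α : Type} : NF α → NF α
    | .var a => .neg (.neg (.var a))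
    | .top => .top
    | .bot => .bot
    | .conj A B => .conj (nnf2 A) (nnf2 B)
    | .disj A B => .disj (nnf2 A) (nnf2 B)
    | .neg A => nnf1 A
end

/-- Conjunctive normal form (list of disjunction-lists of leaves). -/
def cnfNF {α : Type} : NF α → List (List (NF α))
  | .conj A B => cnfNF A ++ cnfNF B
  | .disj A B => (cnfNF A).flatMap fun c => (cnfNF B).map fun d => c ++ d
  | F => [[F]]

/-- Disjunctive normal form (list of conjunction-lists of leaves). -/
def dnfNF {α : Type} : NF α → List (List (NF α))
  | .disj A B => dnfNF A ++ dnfNF B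
  | .conj A B => (dnfNF A).flatMap fun c => (dnfNF B).map fun d => c ++ d
  | F => [[F]]

/-- Read a leaf as a literal (if it is one). -/
def leafLit {α : Type} : NF α → Option (α × Bool)
  | .var a => some (a, true)
  | .neg (.var a) => some (a, false)
  | _ => none

/-- Read a leaf `¬¬a` as the literal `¬a` to be moved to the other side. -/
def dnegLit {α : Type} : NF α → Option (α × Bool)
  | .neg (.neg (.var a)) => some (a, false)
  | _ => none

/-- Build a free clause from a head disjunct-list and a body conjunct-list:
doubly negated atoms `¬¬a` in the head become `¬a` in the body and vice versa;
trivial clauses (⊤ in the head or ⊥ in the body) are removed. -/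
def procClause {α : Type} [DecidableEq α] (hd bd : List (NF α)) :
    Option (FClause α) :=
  if NF.top ∈ hd ∨ NF.bot ∈ bd then none
  else some ⟨hd.filterMap leafLit ++ bd.filterMap dnegLit,
             bd.filterMap leafLit ++ hd.filterMap dnegLit⟩

/-- `AugFree(P)`: the free program obtained from the augmented program `P` by
pushing negations inward, taking CNF of heads and DNF of bodies, splitting
conjunctions in heads and disjunctions in bodies into separate clauses, and
eliminating doubly negated atoms. -/
def augFree {α : Type} [DecidableEq α] (P : List (AugClause α)) :
    List (FClause α) :=
  P.flatMap fun c =>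
    (cnfNF (nnf0 c.1)).flatMap fun hd =>
      (dnfNF (nnf0 c.2)).filterMap fun bd => procClause hd bd

/-- Positive formulas: no negation (in particular no ⊥) occurs. -/
def IsPositive {α : Type} : PropForm α → Prop
  | .var _ => True
  | .fals => False
  | .conj A B => IsPositive A ∧ IsPositive B
  | .disj A B => IsPositive A ∧ IsPositive B
  | .impl A B => IsPositive A ∧ IsPositive B

/-- The set 𝐍 of two-negated formulas. -/
inductive IsTwoNeg {α : Type} : PropForm α → Prop
  | atom (a : α) : IsTwoNeg (neg (neg (var a)))
  | dneg {A} : IsTwoNeg A → IsTwoNeg (neg (neg A))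
  | conj {A B} : IsTwoNeg A → IsTwoNeg B → IsTwoNeg (PropForm.conj A B)
  | disjL {A} (B) : IsTwoNeg A → IsTwoNeg (PropForm.disj A B)
  | disjR {A} (B) : IsTwoNeg A → IsTwoNeg (PropForm.disj B A)
  | himp {A} (B) : IsTwoNeg A → IsTwoNeg (PropForm.impl B A)

section Derivability

variable {α : Type} {Γ Δ : Set (PropForm α)} {A B C F p : PropForm α}

/-- Induction on derivations that treats all logical axioms uniformly. -/
lemma Deriv.induction_of_logical {motive : PropForm α → Prop} (ax : ∀ B ∈ Γ, motive B)
    (logical : ∀ B, (∀ Θ : Set (PropForm α), Deriv Θ B) → motive B)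
    (mp : ∀ B C, motive (impl B C) → motive B → motive C) (d : Deriv Γ A) : motive A := by
  induction d with
  | ax h => exact ax _ h
  | k A B => exact logical _ fun _ => .k A B
  | s A B C => exact logical _ fun _ => .s A B C
  | conjIntro A B => exact logical _ fun _ => .conjIntro A B
  | conjElimL A B => exact logical _ fun _ => .conjElimL A B
  | conjElimR A B => exact logical _ fun _ => .conjElimR A B
  | disjIntroL A B => exact logical _ fun _ => .disjIntroL A B
  | disjIntroR A B => exact logical _ fun _ => .disjIntroR A B
  | disjElim A B C => exact logical _ fun _ => .disjElim A B C
  | falsElim A => exact logical _ fun _ => .falsElim A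
  | mp _ _ h1 h2 => exact mp _ _ h1 h2

lemma Deriv.mono (h : Γ ⊆ Δ) (d : Deriv Γ A) : Deriv Δ A :=
  d.induction_of_logical (fun _ hB => .ax (h hB)) (fun _ hB => hB Δ) fun _ _ h1 h2 => .mp h1 h2

lemma Deriv.weaken (d : Deriv Γ A) : Deriv Γ (impl B A) := .mp (.k A B) d

lemma Deriv.trans (h1 : Deriv Γ (impl A B)) (h2 : Deriv Γ (impl B C)) :
    Deriv Γ (impl A C) :=
  .mp (.mp (.s A B C) h2.weaken) h1

lemma Deriv.refl (A : PropForm α) : Deriv Γ (impl A A) :=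
  .mp (.mp (.s A (impl A A) A) (.k A (impl A A))) (.k A A)

/-- The deduction theorem. -/
lemma Deriv.deduction (d : Deriv (insert A Γ) B) : Deriv Γ (impl A B) := by
  refine d.induction_of_logical (motive := fun B => Deriv Γ (PropForm.impl A B)) ?_
    (fun _ hB => (hB Γ).weaken) fun _ _ h1 h2 => .mp (.mp (.s _ _ _) h1) h2
  rintro B (rfl | hB)
  · exact .refl _
  · exact (Deriv.ax hB).weaken

lemma Deriv.hyp : Deriv (insert A Γ) A := .ax (Set.mem_insert _ _)

lemma Deriv.lift (d : Deriv Γ A) : Deriv (insert B Γ) A := d.mono (Set.subset_insert _ _)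

lemma Deriv.conj (h1 : Deriv Γ A) (h2 : Deriv Γ B) : Deriv Γ (PropForm.conj A B) :=
  .mp (.mp (.conjIntro A B) h1) h2

lemma Deriv.disj_imp (h1 : Deriv Γ (impl A C)) (h2 : Deriv Γ (impl B C)) :
    Deriv Γ (impl (PropForm.disj A B) C) :=
  .mp (.mp (.disjElim A B C) h1) h2

lemma Deriv.bigConj_imp {L : List (PropForm α)} (hA : A ∈ L) :
    Deriv Γ (impl (bigConj L) A) := by
  induction L with
  | nil => simp at hA
  | cons B L ih =>
    cases L with
    | nil =>
      obtain rfl : A = B := by simpa using hA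
      exact .refl _
    | cons C L =>
      rcases List.mem_cons.1 hA with rfl | hA
      · exact .conjElimL _ _
      · exact (Deriv.conjElimR _ _).trans (ih hA)

lemma Deriv.imp_bigConj {L : List (PropForm α)} (h : ∀ B ∈ L, Deriv Γ (impl A B)) :
    Deriv Γ (impl A (bigConj L)) := by
  induction L with
  | nil => exact (Deriv.refl _).weaken
  | cons B L ih =>
    cases L with
    | nil => exact h B (by simp)
    | cons C L =>
      have h1 := h B (by simp)
      have h2 := ih fun D hD => h D (List.mem_cons_of_mem _ hD)
      exact Deriv.deduction (.conj (.mp h1.lift .hyp) (.mp h2.lift .hyp))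

lemma Deriv.iProves (d : Deriv Γ A) : IProves Γ A := by
  refine d.induction_of_logical (fun B hB => ⟨[B], by simpa using hB, .refl _⟩)
    (fun B hB => ⟨[], by simp, (hB ∅).weaken⟩) ?_
  rintro B C ⟨L, hL, dL⟩ ⟨M, hM, dM⟩
  refine ⟨L ++ M, fun G hG => (List.mem_append.1 hG).elim (hL G) (hM G), ?_⟩
  have d1 : Deriv ∅ (impl (bigConj (L ++ M)) (impl B C)) := Deriv.trans
    (.imp_bigConj fun G hG => .bigConj_imp (List.mem_append_left M hG)) dL
  have d2 : Deriv ∅ (impl (bigConj (L ++ M)) B) := Deriv.trans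
    (.imp_bigConj fun G hG => .bigConj_imp (List.mem_append_right L hG)) dM
  exact .mp (.mp (.s _ _ _) d1) d2

lemma not_iConsistent_of_deriv (h1 : Deriv Γ A) (h2 : Deriv Γ (neg A)) : ¬ IConsistent Γ :=
  fun h => h (Deriv.mp h2 h1).iProves

end Derivability

section Semantics

variable {α : Type} {Γ : Set (PropForm α)} {F : PropForm α} {I J : α → Fin 3}

/-- The truth function of implication in G3. -/
def g3Imp (v w : Fin 3) : Fin 3 := if v ≤ w then 2 else w

lemma g3_impl (A B : PropForm α) : g3 I (impl A B) = g3Imp (g3 I A) (g3 I B) := rfl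

lemma g3_conj (A B : PropForm α) : g3 I (conj A B) = min (g3 I A) (g3 I B) := rfl

lemma g3_disj (A B : PropForm α) : g3 I (disj A B) = max (g3 I A) (g3 I B) := rfl

/-- Soundness of intuitionistic derivability for G3. -/
lemma g3_eq_two_of_deriv (hΓ : ∀ G ∈ Γ, g3 I G = 2) (d : Deriv Γ F) : g3 I F = 2 := by
  induction d with
  | ax h => exact hΓ _ h
  | @mp A B _ _ h1 h2 =>
    rw [g3_impl] at h1
    revert h1 h2
    generalize g3 I A = x, g3 I B = y
    decide +revert
  | falsElim A => simp [g3]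
  | s A B C | disjElim A B C =>
    simp only [g3_impl, g3_disj]
    generalize g3 I A = x, g3 I B = y, g3 I C = z
    decide +revert
  | k A B | conjIntro A B | conjElimL A B | conjElimR A B | disjIntroL A B | disjIntroR A B =>
    simp only [g3_impl, g3_conj, g3_disj]
    generalize g3 I A = x, g3 I B = y
    decide +revert

lemma g3_eq_two_of_iProves (hΓ : ∀ G ∈ Γ, g3 I G = 2) (h : IProves Γ F) : g3 I F = 2 := by
  obtain ⟨L, hL, d⟩ := h
  refine g3_eq_two_of_deriv hΓ (.mp (d.mono (Set.empty_subset _)) ?_)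
  exact .mp (Deriv.imp_bigConj fun B hB => (Deriv.ax (hL B hB)).weaken) (Deriv.refl fals)

lemma iConsistent_of_g3 (hΓ : ∀ G ∈ Γ, g3 I G = 2) : IConsistent Γ := fun h => by
  simpa [g3] using g3_eq_two_of_iProves hΓ h

lemma g3_congr (h : ∀ a ∈ F.atoms, I a = J a) : g3 I F = g3 J F := by
  induction F with
  | var a => exact h a rfl
  | fals => rfl
  | conj A B ihA ihB | disj A B ihA ihB | impl A B ihA ihB =>
    simp only [g3, ihA fun a ha => h a (.inl ha), ihB fun a ha => h a (.inr ha)]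

/-- The two-valued collapse of a truth value, identifying `1` with `2`. -/
def collapse (v : Fin 3) : Fin 3 := if v = 0 then 0 else 2

lemma g3_collapse (I : α → Fin 3) (F : PropForm α) :
    g3 (fun a => collapse (I a)) F = collapse (g3 I F) := by
  induction F with
  | var a => rfl
  | fals => rfl
  | conj A B ihA ihB | disj A B ihA ihB | impl A B ihA ihB =>
    simp only [g3_conj, g3_disj, g3_impl, ihA, ihB]
    generalize g3 I A = x, g3 I B = y
    decide +revert

lemma PropForm.finite_atoms (F : PropForm α) : F.atoms.Finite := by
  induction F with
  | var a => exact Set.finite_singleton a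
  | fals => exact Set.finite_empty
  | conj A B ihA ihB | disj A B ihA ihB | impl A B ihA ihB => exact ihA.union ihB

lemma finite_sigTh (h : Γ.Finite) : (sigTh Γ).Finite := h.biUnion fun F _ => F.finite_atoms

lemma atoms_subset_sigTh (h : F ∈ Γ) : F.atoms ⊆ sigTh Γ := Set.subset_biUnion_of_mem h

end Semantics

section Descriptions

variable {α : Type} {Γ : Set (PropForm α)} {S : Set α} {A B F p : PropForm α} {I : α → Fin 3}

/-- Formulas asserting that `A` is refuted, equivalent to `p`, or true, according to the
truth value `v`. -/
def valueTh (p A : PropForm α) (v : Fin 3) : Set (PropForm α) :=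
  {F | v = 0 ∧ F = neg A ∨ v = 1 ∧ (F = impl A p ∨ F = impl p A) ∨ v = 2 ∧ F = A}

/-- The theory describing `I` on `S`, with `p` playing the role of the value `1`. -/
def interpTh (p : PropForm α) (I : α → Fin 3) (S : Set α) : Set (PropForm α) :=
  insert (neg (neg p)) (⋃ a ∈ S, valueTh p (var a) (I a))

/-- `Γ` proves that `A` has the truth value `v`, with `p` playing the role of `1`. -/
def DerivValue (Γ : Set (PropForm α)) (p A : PropForm α) (v : Fin 3) : Prop :=
  (v = 0 → Deriv Γ (neg A)) ∧ (v = 1 → Deriv Γ (impl A p) ∧ Deriv Γ (impl p A)) ∧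
    (v = 2 → Deriv Γ A)

lemma derivValue_zero : DerivValue Γ p A 0 ↔ Deriv Γ (neg A) := by simp [DerivValue]

lemma derivValue_one : DerivValue Γ p A 1 ↔ Deriv Γ (impl A p) ∧ Deriv Γ (impl p A) := by
  simp [DerivValue]

lemma derivValue_two : DerivValue Γ p A 2 ↔ Deriv Γ A := by simp [DerivValue]

lemma DerivValue.conj {v w : Fin 3} (hA : DerivValue Γ p A v) (hB : DerivValue Γ p B w) :
    DerivValue Γ p (PropForm.conj A B) (min v w) := by
  have hl : Deriv Γ (impl (PropForm.conj A B) A) := .conjElimL A B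
  have hr : Deriv Γ (impl (PropForm.conj A B) B) := .conjElimR A B
  match v, w with
  | 0, 0 | 0, 1 | 0, 2 => exact derivValue_zero.2 (hl.trans (derivValue_zero.1 hA))
  | 1, 0 | 2, 0 => exact derivValue_zero.2 (hr.trans (derivValue_zero.1 hB))
  | 1, 1 =>
    rw [derivValue_one] at hA hB
    exact derivValue_one.2 ⟨hl.trans hA.1,
      .deduction (.conj (.mp hA.2.lift .hyp) (.mp hB.2.lift .hyp))⟩
  | 1, 2 =>
    rw [derivValue_one] at hA
    rw [derivValue_two] at hB
    exact derivValue_one.2 ⟨hl.trans hA.1,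
      .deduction (.conj (.mp hA.2.lift .hyp) hB.lift)⟩
  | 2, 1 =>
    rw [derivValue_two] at hA
    rw [derivValue_one] at hB
    exact derivValue_one.2 ⟨hr.trans hB.1,
      .deduction (.conj hA.lift (.mp hB.2.lift .hyp))⟩
  | 2, 2 => exact derivValue_two.2 (.conj (derivValue_two.1 hA) (derivValue_two.1 hB))

lemma DerivValue.disj {v w : Fin 3} (hA : DerivValue Γ p A v) (hB : DerivValue Γ p B w) :
    DerivValue Γ p (PropForm.disj A B) (max v w) := by
  have hl : Deriv Γ (impl A (PropForm.disj A B)) := .disjIntroL A B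
  have hr : Deriv Γ (impl B (PropForm.disj A B)) := .disjIntroR A B
  match v, w with
  | 2, 0 | 2, 1 | 2, 2 => exact derivValue_two.2 (.mp hl (derivValue_two.1 hA))
  | 0, 2 | 1, 2 => exact derivValue_two.2 (.mp hr (derivValue_two.1 hB))
  | 0, 0 => exact derivValue_zero.2 (.disj_imp (derivValue_zero.1 hA) (derivValue_zero.1 hB))
  | 0, 1 =>
    rw [derivValue_zero] at hA
    rw [derivValue_one] at hB
    exact derivValue_one.2 ⟨.disj_imp (hA.trans (.falsElim p)) hB.1, hB.2.trans hr⟩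
  | 1, 0 =>
    rw [derivValue_one] at hA
    rw [derivValue_zero] at hB
    exact derivValue_one.2 ⟨.disj_imp hA.1 (hB.trans (.falsElim p)), hA.2.trans hl⟩
  | 1, 1 =>
    rw [derivValue_one] at hA hB
    exact derivValue_one.2 ⟨.disj_imp hA.1 hB.1, hA.2.trans hl⟩

lemma DerivValue.impl (hp : Deriv Γ (neg (neg p))) {v w : Fin 3} (hA : DerivValue Γ p A v)
    (hB : DerivValue Γ p B w) :
    DerivValue Γ p (PropForm.impl A B) (if v ≤ w then 2 else w) := by
  match v, w with
  | 0, 0 | 0, 1 => exact derivValue_two.2 ((derivValue_zero.1 hA).trans (.falsElim B))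
  | 0, 2 | 1, 2 | 2, 2 => exact derivValue_two.2 (derivValue_two.1 hB).weaken
  | 1, 1 =>
    rw [derivValue_one] at hA hB
    exact derivValue_two.2 (hA.1.trans hB.2)
  | 1, 0 =>
    rw [derivValue_one] at hA
    rw [derivValue_zero] at hB
    exact derivValue_zero.2 (.deduction (.mp hp.lift ((hA.2.lift.trans .hyp).trans hB.lift)))
  | 2, 0 =>
    rw [derivValue_two] at hA
    rw [derivValue_zero] at hB
    exact derivValue_zero.2 (.deduction (.mp hB.lift (.mp .hyp hA.lift)))
  | 2, 1 =>
    rw [derivValue_two] at hA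
    rw [derivValue_one] at hB
    exact derivValue_one.2 ⟨.deduction (.mp hB.1.lift (.mp .hyp hA.lift)), hB.2.trans (.k B A)⟩

lemma derivValue_g3 (hΓ : interpTh p I S ⊆ Γ) (hF : F.atoms ⊆ S) :
    DerivValue Γ p F (g3 I F) := by
  induction F with
  | var a =>
    have h : valueTh p (var a) (I a) ⊆ Γ := fun G hG =>
      hΓ (.inr (Set.mem_biUnion (hF rfl) hG))
    exact ⟨fun h0 => .ax (h (.inl ⟨h0, rfl⟩)),
      fun h1 => ⟨.ax (h (.inr (.inl ⟨h1, .inl rfl⟩))), .ax (h (.inr (.inl ⟨h1, .inr rfl⟩)))⟩,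
      fun h2 => .ax (h (.inr (.inr ⟨h2, rfl⟩)))⟩
  | fals => exact derivValue_zero.2 (.refl _)
  | conj A B ihA ihB =>
    exact (ihA (Set.subset_union_left.trans hF)).conj (ihB (Set.subset_union_right.trans hF))
  | disj A B ihA ihB =>
    exact (ihA (Set.subset_union_left.trans hF)).disj (ihB (Set.subset_union_right.trans hF))
  | impl A B ihA ihB =>
    exact .impl (.ax (hΓ (.inl rfl))) (ihA (Set.subset_union_left.trans hF))
      (ihB (Set.subset_union_right.trans hF))

lemma finite_interpTh (hS : S.Finite) : (interpTh p I S).Finite := by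
  refine (hS.biUnion fun a _ => ?_).insert _
  refine (Set.toFinite {neg (var a), PropForm.impl (var a) p,
    PropForm.impl p (var a), var a}).subset fun F hF => ?_
  simp only [valueTh, Set.mem_ofPred_eq] at hF
  simp only [Set.mem_insert_iff, Set.mem_singleton_iff]
  tauto

lemma sigTh_interpTh_subset (hp : p.atoms ⊆ S) : sigTh (interpTh p I S) ⊆ S := by
  refine Set.iUnion₂_subset fun F hF => ?_
  rcases hF with rfl | hF
  · simpa [neg, PropForm.atoms] using hp
  · obtain ⟨a, ha, h⟩ := Set.mem_iUnion₂.1 hF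
    rcases h with ⟨_, rfl⟩ | ⟨_, rfl | rfl⟩ | ⟨_, rfl⟩ <;>
      simp [neg, PropForm.atoms, ha, hp, Set.insert_subset_iff]

lemma g3_interpTh {K : α → Fin 3} (hp : g3 K p ≠ 0) (h0 : ∀ a ∈ S, I a = 0 → K a = 0)
    (h1 : ∀ a ∈ S, I a = 1 → K a = g3 K p) (h2 : ∀ a ∈ S, I a = 2 → K a = 2) :
    ∀ F ∈ interpTh p I S, g3 K F = 2 := by
  rintro F (rfl | hF)
  · simp [neg, g3, hp]
  · obtain ⟨a, ha, h⟩ := Set.mem_iUnion₂.1 hF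
    rcases h with ⟨h, rfl⟩ | ⟨h, rfl | rfl⟩ | ⟨h, rfl⟩
    · simp [neg, g3, h0 a ha h]
    · simp [g3, h1 a ha h]
    · simp [g3, h1 a ha h]
    · exact h2 a ha h

lemma sigTh_union (Γ Δ : Set (PropForm α)) : sigTh (Γ ∪ Δ) = sigTh Γ ∪ sigTh Δ :=
  Set.biUnion_union _ _ _

lemma iComplete_union_interpTh {T : Set (PropForm α)} (hT : sigTh T ⊆ S) (hp : p.atoms ⊆ S)
    (d : Deriv (T ∪ interpTh p I S) p) : IComplete (T ∪ interpTh p I S) := by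
  intro a ha
  have haS : a ∈ S := by
    rw [sigTh_union] at ha
    exact Set.union_subset hT (sigTh_interpTh_subset hp) ha
  have hv : DerivValue (T ∪ interpTh p I S) p (var a) (g3 I (var a)) :=
    derivValue_g3 Set.subset_union_right (Set.singleton_subset_iff.2 haS)
  generalize g3 I (var a) = v at hv
  match v with
  | 0 => exact .inr (derivValue_zero.1 hv).iProves
  | 1 => exact .inl (Deriv.mp (derivValue_one.1 hv).2 d).iProves
  | 2 => exact .inl (derivValue_two.1 hv).iProves

end Descriptions

/-- if some 3-valued interpretation models `P1` and not `P2`,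
then there is a program `P` such that either (i) `P1 ∪ P` is intuitionistically
consistent and complete while `P2 ∪ P` is inconsistent, or (ii) `P1 ∪ P` is
incomplete and cannot be made simultaneously consistent and complete by adding
any set of negated atoms, while `P2 ∪ P` is consistent and complete. -/
theorem g3_model_separation_program {α : Type} (P1 P2 : Set (PropForm α))
    (h1 : P1.Finite) (h2 : P2.Finite) (I : α → Fin 3)
    (hI1 : ∀ F ∈ P1, g3 I F = 2) (hI2 : ¬ ∀ F ∈ P2, g3 I F = 2) :
    ∃ P : Set (PropForm α), P.Finite ∧
      ((IConsistent (P1 ∪ P) ∧ IComplete (P1 ∪ P) ∧ ¬ IConsistent (P2 ∪ P)) ∨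
        (¬ IComplete (P1 ∪ P) ∧
          (∀ Δ : Set α,
            ¬ (IConsistent (P1 ∪ P ∪ negSet Δ) ∧ IComplete (P1 ∪ P ∪ negSet Δ))) ∧
          IConsistent (P2 ∪ P) ∧ IComplete (P2 ∪ P))) := by
  classical
  set S : Set α := sigTh P1 ∪ sigTh P2 with hS
  have hSfin : S.Finite := (finite_sigTh h1).union (finite_sigTh h2)
  wlog hout : ∀ a ∉ S, I a = 0 generalizing I
  · have hcongr (F : PropForm α) (hF : F.atoms ⊆ S) :
        g3 (fun a => if a ∈ S then I a else 0) F = g3 I F :=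
      g3_congr fun a ha => if_pos (hF ha)
    refine this (fun a => if a ∈ S then I a else 0) (fun F hF => ?_) (fun h => hI2 fun F hF => ?_)
      (fun a ha => if_neg ha)
    · rw [hcongr F ((atoms_subset_sigTh hF).trans Set.subset_union_left), hI1 F hF]
    · rw [← hcongr F ((atoms_subset_sigTh hF).trans Set.subset_union_right), h F hF]
  set J : α → Fin 3 := fun a => collapse (I a) with hJ
  have hJ1 : ∀ F ∈ P1, g3 J F = 2 := fun F hF => by rw [g3_collapse, hI1 F hF]; rfl
  by_cases hzero : ∃ F ∈ P2, g3 I F = 0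
  · obtain ⟨F, hF, hF0⟩ := hzero
    have hJne (a : α) : J a ≠ 1 := by
      simp only [hJ, collapse]
      split_ifs <;> decide
    have htop : (top : PropForm α).atoms ⊆ S := by simp [top, PropForm.atoms]
    refine ⟨interpTh top J S, finite_interpTh hSfin, .inl ⟨iConsistent_of_g3 (I := J) ?_,
      iComplete_union_interpTh Set.subset_union_left htop (.refl _), ?_⟩⟩
    · rintro G (hG | hG)
      · exact hJ1 G hG
      · exact g3_interpTh (by simp [top, g3]) (fun _ _ h => h) (fun a _ h => (hJne a h).elim)
          (fun _ _ h => h) G hG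
    · have hv : DerivValue (P2 ∪ interpTh top J S) top F (g3 J F) :=
        derivValue_g3 Set.subset_union_right
          ((atoms_subset_sigTh hF).trans Set.subset_union_right)
      rw [g3_collapse, hF0] at hv
      exact not_iConsistent_of_deriv (.ax (.inl hF)) (derivValue_zero.1 hv)
  · push Not at hzero hI2
    obtain ⟨F, hF, hF2⟩ := hI2
    have hFS : F.atoms ⊆ S := (atoms_subset_sigTh hF).trans Set.subset_union_right
    have hF1 : g3 I F = 1 := by
      have := hzero F hF
      omega
    obtain ⟨b, hbS, hb⟩ : ∃ b ∈ S, I b = 1 := by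
      by_contra! hne
      have hIJ : g3 I F = g3 J F := g3_congr fun a ha => by
        have := hne a (hFS ha)
        simp only [hJ]
        generalize I a = v at this
        revert v
        decide
      rw [g3_collapse, hF1] at hIJ
      exact absurd hIJ (by decide)
    have hbS' : (var b).atoms ⊆ S := Set.singleton_subset_iff.2 hbS
    have hIP : ∀ G ∈ interpTh (var b) I S, g3 I G = 2 :=
      g3_interpTh (by simp [g3, hb]) (fun _ _ h => h) (fun a _ h => by simp [g3, h, hb])
        (fun _ _ h => h)
    have hJb : J b = 2 := by simp [hJ, hb, collapse]
    have hJP : ∀ G ∈ interpTh (var b) I S, g3 J G = 2 :=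
      g3_interpTh (by simp [g3, hJb]) (fun a _ h => by simp [hJ, h, collapse])
        (fun a _ h => by simp only [g3, hJb]; simp [hJ, h, collapse])
        (fun a _ h => by simp [hJ, h, collapse])
    have hnot {T : Set (PropForm α)} (hT : ∀ G ∈ T, g3 I G = 2)
        (hb' : neg (neg (var b)) ∈ T) : ¬ IComplete T := fun hc => by
      rcases hc b (atoms_subset_sigTh hb' (by simp [neg, PropForm.atoms])) with h | h
      · simpa [g3, hb] using g3_eq_two_of_iProves hT h
      · simpa [g3, neg, hb] using g3_eq_two_of_iProves hT h
    have hIT : ∀ G ∈ P1 ∪ interpTh (var b) I S, g3 I G = 2 :=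
      fun G hG => hG.elim (hI1 G) (hIP G)
    refine ⟨interpTh (var b) I S, finite_interpTh hSfin,
      .inr ⟨hnot hIT (.inr (.inl rfl)), ?_, ?_, ?_⟩⟩
    · rintro Δ ⟨hcons, hcomp⟩
      by_cases hΔ : ∀ a ∈ Δ, I a = 0
      · refine hnot (fun G hG => ?_) (.inl (.inr (.inl rfl))) hcomp
        rcases hG with hG | ⟨a, ha, rfl⟩
        · exact hIT G hG
        · simp [neg, g3, hΔ a ha]
      · push Not at hΔ
        obtain ⟨a, ha, ha0⟩ := hΔ
        have haS : a ∈ S := by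
          by_contra h
          exact ha0 (hout a h)
        have hsub : interpTh (var b) I S ⊆ P1 ∪ interpTh (var b) I S ∪ negSet Δ :=
          Set.subset_union_right.trans Set.subset_union_left
        have hna : Deriv (P1 ∪ interpTh (var b) I S ∪ negSet Δ) (neg (var a)) :=
          .ax (.inr ⟨a, ha, rfl⟩)
        have hv := derivValue_g3 (F := var a) hsub (Set.singleton_subset_iff.2 haS)
        simp only [g3] at hv
        generalize I a = v at hv ha0
        match v with
        | 0 => exact ha0 rfl
        | 1 =>
          exact not_iConsistent_of_deriv ((derivValue_one.1 hv).2.trans hna)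
            (.ax (hsub (.inl rfl))) hcons
        | 2 => exact not_iConsistent_of_deriv (derivValue_two.1 hv) hna hcons
    · refine iConsistent_of_g3 (I := J) fun G hG => hG.elim (fun hG => ?_) (hJP G)
      rw [g3_collapse, collapse, if_neg (hzero G hG)]
    · have hv : DerivValue (P2 ∪ interpTh (var b) I S) (var b) F (g3 I F) :=
        derivValue_g3 Set.subset_union_right hFS
      rw [hF1] at hv
      exact iComplete_union_interpTh Set.subset_union_right hbS'
        (.mp (derivValue_one.1 hv).1 (.ax (.inl hF)))

end ASP
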